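/- For every n ≥ 1 and all k, r with 1 ≤ r ≤ n and 0 ≤ k ≤ n - r, the number of labeled plane trees with n edges whose root is labeled 1, whose root has exactly r children, and which have exactly k improper edges equals S_{n,r} · binom(n-r, k), where S_{n,r} is the number of increasing plane trees with n edges whose root has exactly r children. -/

import Mathlib

/-- A plane tree with labeled vertices: a root label together with an ordered
list of child subtrees.  (A plane tree is a rooted tree in which the children
of each node are linearly ordered.) -/
inductive LTree : Type where
  | node : ℕ → List LTree → LTree

namespace LTree

/-- The label of the root. -/
def rootLabel : LTree → ℕ
  | node a _ => a

/-- The list of child subtrees of the root. -/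
def children : LTree → List LTree
  | node _ cs => cs

/-- `deg_T(root)`: the number of children of the root. -/
def rootDeg (t : LTree) : ℕ := (children t).length

mutual
  /-- The list of all vertex labels of a tree. -/
  def labels : LTree → List ℕ
    | node a cs => a :: labelsList cs
  /-- The list of all vertex labels of a forest. -/
  def labelsList : List LTree → List ℕ
    | [] => []
    | c :: rest => labels c ++ labelsList rest
end

/-- `β(v)`: the smallest label occurring in the subtree `t` rooted at `v`. -/
def minLabel (t : LTree) : ℕ := (labels t).foldr min (rootLabel t)

/-- `min { j, β(c₁), …, β(cₖ) }` for a vertex `j` and a list of subtrees `c₁, …, cₖ`. -/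
def minOver (j : ℕ) (rest : List LTree) : ℕ := (rest.map minLabel).foldr min j

mutual
  /-- The list of edges of a tree, each recorded as a (parent label, child label)
  pair, in depth-first order. -/
  def edgeList : LTree → List (ℕ × ℕ)
    | node a cs => edgeListAux a cs
  def edgeListAux : ℕ → List LTree → List (ℕ × ℕ)
    | _, [] => []
    | a, c :: rest => (a, rootLabel c) :: (edgeList c ++ edgeListAux a rest)
end

mutual
  /-- The list of improper edges of a tree: if a vertex `j` has children
  `j₁, …, jₖ` (ordered left to right), the edge `(j, jᵢ)` is improper when
  `β(jᵢ) < min { j, β(j_{i+1}), …, β(jₖ) }`. -/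
  def improperEdges : LTree → List (ℕ × ℕ)
    | node a cs => improperEdgesAux a cs
  def improperEdgesAux : ℕ → List LTree → List (ℕ × ℕ)
    | _, [] => []
    | j, c :: rest =>
        (if minLabel c < minOver j rest then [(j, rootLabel c)] else [])
          ++ improperEdges c ++ improperEdgesAux j rest
end

mutual
  /-- The list of proper (i.e. non-improper) edges of a tree. -/
  def properEdges : LTree → List (ℕ × ℕ)
    | node a cs => properEdgesAux a cs
  def properEdgesAux : ℕ → List LTree → List (ℕ × ℕ)
    | _, [] => []
    | j, c :: rest =>
        (if minLabel c < minOver j rest then [] else [(j, rootLabel c)])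
          ++ properEdges c ++ properEdgesAux j rest
end

/-- `impr T`: the number of improper edges of `T`. -/
def impr (t : LTree) : ℕ := (improperEdges t).length

/-- `prop T`: the number of proper edges of `T`. -/
def propCount (t : LTree) : ℕ := (properEdges t).length

/-- The number of edges of `T`. -/
def edgeCount (t : LTree) : ℕ := (edgeList t).length

/-- `T` is a labeled plane tree with `n` edges: its `n + 1` vertices are labeled
bijectively with `{1, 2, …, n + 1}`. -/
def IsLPT (n : ℕ) (t : LTree) : Prop := (labels t).Perm (List.range' 1 (n + 1))

/-- `T` is increasing: vertex labels increase along every path from the root. -/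
inductive Increasing : LTree → Prop where
  | node (a : ℕ) (cs : List LTree) :
      (∀ c ∈ cs, a < rootLabel c) → (∀ c ∈ cs, Increasing c) → Increasing (node a cs)

end LTree

/-- `S_{n,r}`: the number of increasing plane trees with `n` edges whose root has
exactly `r` children. -/
noncomputable def Snr (n r : ℕ) : ℕ :=
  Nat.card {T : LTree // LTree.IsLPT n T ∧ LTree.Increasing T ∧ LTree.rootDeg T = r}


namespace LTree

/-- Attach `c` as the new leftmost child of the root of `t`. -/
def graft (c : LTree) : LTree → LTree
  | node a cs => node a (c :: cs)

mutual
  theorem graftInd {P : LTree → Prop} (h0 : ∀ a, P (node a []))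
      (h1 : ∀ c t, P c → P t → P (graft c t)) : ∀ t, P t
    | node a cs => graftIndAux h0 h1 a cs
  theorem graftIndAux {P : LTree → Prop} (h0 : ∀ a, P (node a []))
      (h1 : ∀ c t, P c → P t → P (graft c t)) : ∀ a cs, P (node a cs)
    | a, [] => h0 a
    | a, c :: rest => h1 c (node a rest) (graftInd h0 h1 c) (graftIndAux h0 h1 a rest)
end

/-- The set of labels. -/
def lab (t : LTree) : Finset ℕ := (labels t).toFinset

theorem labels_graft (c t : LTree) : (labels (graft c t)).Perm (labels c ++ labels t) := by
  cases t with
  | node a cs =>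
    simp only [graft, labels, labelsList]
    exact List.perm_middle.symm

theorem lab_node (a : ℕ) : lab (node a []) = {a} := by simp [lab, labels, labelsList]

theorem lab_graft (c t : LTree) : lab (graft c t) = lab c ∪ lab t := by
  ext x
  simp [lab, (labels_graft c t).mem_iff]

theorem rootLabel_graft (c t : LTree) : rootLabel (graft c t) = rootLabel t := by
  cases t; rfl

theorem rootDeg_graft (c t : LTree) : rootDeg (graft c t) = rootDeg t + 1 := by
  cases t; rfl

theorem rootLabel_mem (t : LTree) : rootLabel t ∈ lab t := by
  cases t; simp [lab, labels, rootLabel]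

theorem foldr_min_spec (l : List ℕ) (a : ℕ) :
    (l.foldr min a = a ∨ l.foldr min a ∈ l) ∧ l.foldr min a ≤ a ∧ ∀ x ∈ l, l.foldr min a ≤ x := by
  induction l with
  | nil => simp
  | cons b l ih =>
    obtain ⟨h1, h2, h3⟩ := ih
    simp only [List.foldr_cons, List.mem_cons]
    refine ⟨?_, by omega, ?_⟩
    · rcases le_total b (l.foldr min a) with h | h
      · rw [min_eq_left h]; tauto
      · rw [min_eq_right h]; tauto
    · rintro x (rfl | hx)
      · omega
      · have := h3 x hx; omega

theorem minLabel_mem (t : LTree) : minLabel t ∈ lab t := by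
  rcases (foldr_min_spec (labels t) (rootLabel t)).1 with h | h
  · have := rootLabel_mem t
    unfold minLabel; rw [h]; exact this
  · simpa [lab, minLabel] using h

theorem minLabel_le (t : LTree) {x : ℕ} (hx : x ∈ lab t) : minLabel t ≤ x :=
  (foldr_min_spec (labels t) (rootLabel t)).2.2 x (by simpa [lab] using hx)

theorem minLabel_eq {t : LTree} {m : ℕ} (h : m ∈ lab t) (h' : ∀ x ∈ lab t, m ≤ x) :
    minLabel t = m :=
  le_antisymm (minLabel_le t h) (h' _ (minLabel_mem t))

theorem minLabel_node (a : ℕ) : minLabel (node a []) = a := by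
  apply minLabel_eq <;> simp [lab_node]

theorem minLabel_graft (c t : LTree) :
    minLabel (graft c t) = min (minLabel c) (minLabel t) := by
  apply minLabel_eq
  · rw [lab_graft, Finset.mem_union]
    rcases le_total (minLabel c) (minLabel t) with h | h
    · rw [min_eq_left h]; exact Or.inl (minLabel_mem c)
    · rw [min_eq_right h]; exact Or.inr (minLabel_mem t)
  · intro x hx
    rw [lab_graft, Finset.mem_union] at hx
    rcases hx with h | h
    · exact (min_le_left _ _).trans (minLabel_le c h)
    · exact (min_le_right _ _).trans (minLabel_le t h)

theorem minOver_eq (a : ℕ) (cs : List LTree) : minOver a cs = minLabel (node a cs) := by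
  induction cs with
  | nil => rw [minLabel_node]; rfl
  | cons c cs ih =>
    have : minLabel (node a (c :: cs)) = min (minLabel c) (minLabel (node a cs)) :=
      minLabel_graft c (node a cs)
    rw [this, ← ih]; rfl

theorem impr_graft (c t : LTree) :
    impr (graft c t) = (if minLabel c < minLabel t then 1 else 0) + impr c + impr t := by
  cases t with
  | node a cs =>
    simp only [impr, graft, improperEdges, improperEdgesAux, List.length_append, minOver_eq]
    split_ifs <;> simp

theorem increasing_graft (c t : LTree) :
    Increasing (graft c t) ↔ rootLabel t < rootLabel c ∧ Increasing c ∧ Increasing t := by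
  cases t with
  | node a cs =>
    constructor
    · intro h
      cases h with
      | node _ _ h1 h2 =>
        exact ⟨h1 c (by simp), h2 c (by simp), .node _ _ (fun d hd => h1 d (by simp [hd]))
          (fun d hd => h2 d (by simp [hd]))⟩
    · rintro ⟨h, hc, ht⟩
      cases ht with
      | node _ _ h1 h2 =>
        refine .node _ _ ?_ ?_
        · intro d hd
          rcases List.mem_cons.1 hd with rfl | hd
          · exact h
          · exact h1 d hd
        · intro d hd
          rcases List.mem_cons.1 hd with rfl | hd
          · exact hc
          · exact h2 d hd

theorem increasing_leaf (a : ℕ) : Increasing (node a []) := .node _ _ (by simp) (by simp)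

theorem Increasing.min_eq {t : LTree} : Increasing t → minLabel t = rootLabel t := by
  induction t using graftInd with
  | h0 a => intro _; rw [minLabel_node]; rfl
  | h1 c t ihc iht =>
    rw [increasing_graft, minLabel_graft, rootLabel_graft]
    rintro ⟨h, hc, ht⟩
    rw [ihc hc, iht ht]; omega

/-- Combine two trees, putting the smaller root on top. -/
def comb (c t : LTree) : LTree := if rootLabel c < rootLabel t then graft t c else graft c t

mutual
  /-- The increasing rearrangement. -/
  def sortT : LTree → LTree
    | node a cs => sortAux a cs
  def sortAux : ℕ → List LTree → LTree
    | a, [] => node a []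
    | a, c :: rest => comb (sortT c) (sortAux a rest)
end

theorem sortT_graft (c t : LTree) : sortT (graft c t) = comb (sortT c) (sortT t) := by
  cases t; simp [graft, sortT, sortAux]

theorem sortT_leaf (a : ℕ) : sortT (node a []) = node a [] := by simp [sortT, sortAux]

mutual
  /-- The set of marks of the flipped joins. -/
  def flips : LTree → Finset ℕ
    | node a cs => flipsAux a cs
  def flipsAux : ℕ → List LTree → Finset ℕ
    | _, [] => ∅
    | a, c :: rest => (if minLabel c < minLabel (node a rest) then {minLabel (node a rest)} else ∅)
        ∪ (flips c ∪ flipsAux a rest)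
end

theorem flips_graft (c t : LTree) : flips (graft c t) =
    (if minLabel c < minLabel t then {minLabel t} else ∅) ∪ (flips c ∪ flips t) := by
  cases t; simp [graft, flips, flipsAux]

theorem flips_leaf (a : ℕ) : flips (node a []) = ∅ := by simp [flips, flipsAux]

mutual
  /-- Flip the joins marked by `E`. -/
  def unsort (E : Finset ℕ) : LTree → LTree
    | node a cs => unsortAux E a cs
  def unsortAux (E : Finset ℕ) : ℕ → List LTree → LTree
    | a, [] => node a []
    | a, c :: rest => if rootLabel c ∈ E then graft (unsortAux E a rest) (unsort E c)
        else graft (unsort E c) (unsortAux E a rest)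
end

theorem unsort_graft (E : Finset ℕ) (c t : LTree) : unsort E (graft c t) =
    if rootLabel c ∈ E then graft (unsort E t) (unsort E c)
        else graft (unsort E c) (unsort E t) := by
  cases t; simp [graft, unsort, unsortAux]

theorem unsort_leaf (E : Finset ℕ) (a : ℕ) : unsort E (node a []) = node a [] := by
  simp [unsort, unsortAux]

theorem graft_swap (c t : LTree) : (labels (graft c t)).Perm (labels (graft t c)) :=
  (labels_graft c t).trans (List.perm_append_comm.trans (labels_graft t c).symm)

theorem graft_perm {c t c' t' : LTree} (hc : (labels c).Perm (labels c'))
    (ht : (labels t).Perm (labels t')) : (labels (graft c t)).Perm (labels (graft c' t')) :=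
  (labels_graft c t).trans ((hc.append ht).trans (labels_graft c' t').symm)

theorem labels_sortT (t : LTree) : (labels (sortT t)).Perm (labels t) := by
  induction t using graftInd with
  | h0 a => rw [sortT_leaf]
  | h1 c t ihc iht =>
    rw [sortT_graft, comb]
    split_ifs
    · exact (graft_perm iht ihc).trans (graft_swap t c)
    · exact graft_perm ihc iht

theorem labels_unsort (E : Finset ℕ) (t : LTree) : (labels (unsort E t)).Perm (labels t) := by
  induction t using graftInd with
  | h0 a => rw [unsort_leaf]
  | h1 c t ihc iht =>
    rw [unsort_graft]
    split_ifs
    · exact (graft_perm iht ihc).trans (graft_swap t c)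
    · exact graft_perm ihc iht

theorem lab_congr {s t : LTree} (h : (labels s).Perm (labels t)) : lab s = lab t := by
  ext x; simp [lab, h.mem_iff]

theorem minLabel_congr {s t : LTree} (h : lab s = lab t) : minLabel s = minLabel t :=
  minLabel_eq (h ▸ minLabel_mem t) (fun x hx => minLabel_le t (h ▸ hx))

theorem nodup_graft {c t : LTree} (h : (labels (graft c t)).Nodup) :
    (labels c).Nodup ∧ (labels t).Nodup ∧ Disjoint (lab c) (lab t) := by
  rw [(labels_graft c t).nodup_iff, List.nodup_append'] at h
  refine ⟨h.1, h.2.1, ?_⟩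
  rw [lab, lab, List.disjoint_toFinset_iff_disjoint]
  exact h.2.2

theorem min_ne_of_disjoint {c t : LTree} (h : Disjoint (lab c) (lab t)) :
    minLabel c ≠ minLabel t := by
  intro e
  exact Finset.disjoint_left.1 h (minLabel_mem c) (e ▸ minLabel_mem t)

theorem sortT_spec (t : LTree) : (labels t).Nodup →
    Increasing (sortT t) ∧ rootLabel (sortT t) = minLabel t := by
  induction t using graftInd with
  | h0 a => intro _; rw [sortT_leaf, minLabel_node]; exact ⟨increasing_leaf a, rfl⟩
  | h1 c t ihc iht =>
    intro h
    obtain ⟨hc, ht, hd⟩ := nodup_graft h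
    obtain ⟨ic, rc⟩ := ihc hc
    obtain ⟨it, rt⟩ := iht ht
    have hne := min_ne_of_disjoint hd
    rw [sortT_graft, comb, minLabel_graft]
    split_ifs with hlt
    · rw [increasing_graft, rootLabel_graft]
      exact ⟨⟨hlt, it, ic⟩, by omega⟩
    · rw [increasing_graft, rootLabel_graft]
      exact ⟨⟨by omega, ic, it⟩, by omega⟩

theorem flips_sub (t : LTree) : (labels t).Nodup →
    ∀ x ∈ flips t, x ∈ lab t ∧ minLabel t < x := by
  induction t using graftInd with
  | h0 a => simp [flips_leaf]
  | h1 c t ihc iht =>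
    intro h x hx
    obtain ⟨hc, ht, hd⟩ := nodup_graft h
    rw [flips_graft] at hx
    rw [lab_graft, minLabel_graft, Finset.mem_union]
    rcases Finset.mem_union.1 hx with hx | hx
    · split_ifs at hx with hlt
      · rw [Finset.mem_singleton] at hx
        subst hx
        exact ⟨Or.inr (minLabel_mem t), by omega⟩
      · simp at hx
    · rcases Finset.mem_union.1 hx with hx | hx
      · have := ihc hc x hx
        exact ⟨Or.inl this.1, by omega⟩
      · have := iht ht x hx
        exact ⟨Or.inr this.1, by omega⟩

theorem card_flips (t : LTree) : (labels t).Nodup → (flips t).card = impr t := by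
  induction t using graftInd with
  | h0 a => intro _; rw [flips_leaf]; simp [impr, improperEdges, improperEdgesAux]
  | h1 c t ihc iht =>
    intro h
    obtain ⟨hc, ht, hd⟩ := nodup_graft h
    have hdd : Disjoint (flips c) (flips t) := by
      rw [Finset.disjoint_left]
      intro x h1 h2
      exact Finset.disjoint_left.1 hd (flips_sub c hc x h1).1 (flips_sub t ht x h2).1
    rw [flips_graft, impr_graft, Finset.card_union_of_disjoint, Finset.card_union_of_disjoint hdd,
      ihc hc, iht ht]
    · split_ifs <;> simp [add_assoc]
    · split_ifs
      · rw [Finset.disjoint_singleton_left, Finset.mem_union]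
        rintro (hx | hx)
        · exact Finset.disjoint_left.1 hd (flips_sub c hc _ hx).1 (minLabel_mem t)
        · exact lt_irrefl _ (flips_sub t ht _ hx).2
      · simp

theorem unsort_sortT (t : LTree) : (labels t).Nodup → ∀ E : Finset ℕ,
    (∀ x ∈ lab t, x ≠ minLabel t → (x ∈ E ↔ x ∈ flips t)) → unsort E (sortT t) = t := by
  induction t using graftInd with
  | h0 a => intro _ E _; rw [sortT_leaf, unsort_leaf]
  | h1 c t ihc iht =>
    intro h E hE
    obtain ⟨hc, ht, hd⟩ := nodup_graft h
    have hne := min_ne_of_disjoint hd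
    have rc := (sortT_spec c hc).2
    have rt := (sortT_spec t ht).2
    have mc := minLabel_mem c
    have mt := minLabel_mem t
    have hd' := Finset.disjoint_left.1 hd
    have fc := flips_sub c hc
    have ft := flips_sub t ht
    rw [flips_graft, lab_graft, minLabel_graft] at hE
    simp only [Finset.mem_union] at hE
    have Ec : ∀ x ∈ lab c, x ≠ minLabel c → (x ∈ E ↔ x ∈ flips c) := by
      intro x hx hxm
      have hle := minLabel_le c hx
      rw [hE x (Or.inl hx) (by omega)]
      constructor
      · rintro (h1 | h1 | h1)
        · split_ifs at h1 with hl
          · rw [Finset.mem_singleton] at h1; subst h1; exact absurd mt (hd' hx)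
          · simp at h1
        · exact h1
        · exact absurd (ft x h1).1 (hd' hx)
      · tauto
    have Et : ∀ x ∈ lab t, x ≠ minLabel t → (x ∈ E ↔ x ∈ flips t) := by
      intro x hx hxm
      have hle := minLabel_le t hx
      rw [hE x (Or.inr hx) (by omega)]
      constructor
      · rintro (h1 | h1 | h1)
        · split_ifs at h1 with hl
          · rw [Finset.mem_singleton] at h1; exact absurd h1 hxm
          · simp at h1
        · exact absurd hx (hd' (fc x h1).1)
        · exact h1
      · tauto
    rw [sortT_graft, comb, rc, rt]
    split_ifs with hlt
    · have hm : minLabel t ∈ E := by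
        rw [hE _ (Or.inr mt) (by omega), if_pos hlt]
        simp
      rw [unsort_graft, rt, if_pos hm, ihc hc E Ec, iht ht E Et]
    · have hm : minLabel c ∉ E := by
        rw [hE _ (Or.inl mc) (by omega), if_neg hlt]
        rintro (h1 | h1 | h1)
        · simp at h1
        · exact lt_irrefl _ (fc _ h1).2
        · exact hd' mc (ft _ h1).1
      rw [unsort_graft, rc, if_neg hm, ihc hc E Ec, iht ht E Et]

theorem sortT_unsort (E : Finset ℕ) (t : LTree) : Increasing t → sortT (unsort E t) = t := by
  induction t using graftInd with
  | h0 a => intro _; rw [unsort_leaf, sortT_leaf]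
  | h1 c t ihc iht =>
    rw [increasing_graft]
    rintro ⟨h, hc, ht⟩
    rw [unsort_graft]
    split_ifs
    · rw [sortT_graft, ihc hc, iht ht, comb, if_pos h]
    · rw [sortT_graft, ihc hc, iht ht, comb, if_neg (by omega)]

theorem flips_unsort (E : Finset ℕ) (t : LTree) : Increasing t →
    ∀ x, x ∈ flips (unsort E t) ↔ x ∈ E ∧ x ∈ lab t ∧ x ≠ rootLabel t := by
  induction t using graftInd with
  | h0 a => intro _ x; rw [unsort_leaf, flips_leaf, lab_node]; simp [rootLabel]
  | h1 c t ihc iht =>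
    rw [increasing_graft]
    rintro ⟨h, hc, ht⟩ x
    have uc : minLabel (unsort E c) = rootLabel c := by
      rw [minLabel_congr (lab_congr (labels_unsort E c)), hc.min_eq]
    have ut : minLabel (unsort E t) = rootLabel t := by
      rw [minLabel_congr (lab_congr (labels_unsort E t)), ht.min_eq]
    have hx : x ∈ lab c → rootLabel c ≤ x := fun hx => hc.min_eq ▸ minLabel_le c hx
    have rc := rootLabel_mem c
    have ihc := ihc hc x
    have iht := iht ht x
    rw [unsort_graft, lab_graft, rootLabel_graft, Finset.mem_union]
    have key : (x = rootLabel c ∧ rootLabel c ∈ E) ∨ (x ∈ flips (unsort E c)) ∨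
        x ∈ flips (unsort E t) ↔ x ∈ E ∧ (x ∈ lab c ∨ x ∈ lab t) ∧ x ≠ rootLabel t := by
      rw [ihc, iht]
      by_cases hxc : x = rootLabel c
      · subst hxc
        have : rootLabel c ≠ rootLabel t := by omega
        simp [rc, this]
        exact fun h1 _ => h1
      · have : x ∈ lab c → x ≠ rootLabel t := fun h' => by have := hx h'; omega
        clear ihc iht uc ut hc ht hx rc h
        simp only [hxc, false_and, false_or, ne_eq, not_false_eq_true, and_true]
        tauto
    rw [← key]
    split_ifs with hE
    · rw [flips_graft, uc, ut, if_pos h]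
      simp only [Finset.mem_union, Finset.mem_singleton, hE, and_true]
      rw [or_comm (a := x ∈ flips (unsort E t))]
    · rw [flips_graft, uc, ut, if_neg (by omega)]
      simp only [Finset.mem_union, Finset.notMem_empty, hE, and_false]

/-- Labels of the children of the root. -/
def kids (t : LTree) : Finset ℕ := ((children t).map rootLabel).toFinset

theorem kids_graft (c t : LTree) : kids (graft c t) = insert (rootLabel c) (kids t) := by
  cases t; simp [kids, graft, children]

theorem kids_leaf (a : ℕ) : kids (node a []) = ∅ := by simp [kids, children]

theorem kids_sub (t : LTree) : kids t ⊆ lab t := by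
  induction t using graftInd with
  | h0 a => simp [kids_leaf]
  | h1 c t ihc iht =>
    rw [kids_graft, lab_graft]
    intro x hx
    rw [Finset.mem_union]
    rcases Finset.mem_insert.1 hx with rfl | hx
    · exact Or.inl (rootLabel_mem c)
    · exact Or.inr (iht hx)

theorem root_notMem_kids (t : LTree) : Increasing t → rootLabel t ∉ kids t := by
  induction t using graftInd with
  | h0 a => simp [kids_leaf]
  | h1 c t ihc iht =>
    rw [increasing_graft]
    rintro ⟨h, hc, ht⟩
    rw [kids_graft, rootLabel_graft, Finset.mem_insert]
    rintro (h1 | h1)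
    · omega
    · exact iht ht h1

theorem card_kids (t : LTree) : (labels t).Nodup → (kids t).card = rootDeg t := by
  induction t using graftInd with
  | h0 a => intro _; rw [kids_leaf]; rfl
  | h1 c t ihc iht =>
    intro h
    obtain ⟨hc, ht, hd⟩ := nodup_graft h
    rw [kids_graft, rootDeg_graft, Finset.card_insert_of_notMem, iht ht]
    intro hx
    exact Finset.disjoint_left.1 hd (rootLabel_mem c) (kids_sub t hx)

theorem sortT_root (t : LTree) : (labels t).Nodup → rootLabel t = minLabel t →
    rootDeg (sortT t) = rootDeg t ∧ Disjoint (flips t) (kids (sortT t)) := by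
  induction t using graftInd with
  | h0 a => intro _ _; rw [sortT_leaf, flips_leaf]; simp
  | h1 c t ihc iht =>
    intro h hr
    obtain ⟨hc, ht, hd⟩ := nodup_graft h
    rw [rootLabel_graft, minLabel_graft] at hr
    have hne := min_ne_of_disjoint hd
    have hle := minLabel_le t (rootLabel_mem t)
    have rc := (sortT_spec c hc).2
    have rt := (sortT_spec t ht).2
    obtain ⟨h1, h2⟩ := iht ht (by omega)
    have hn : ¬ minLabel c < minLabel t := by omega
    rw [sortT_graft, comb, rc, rt, if_neg hn, rootDeg_graft, rootDeg_graft, h1, flips_graft,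
      if_neg hn, kids_graft, rc]
    refine ⟨rfl, ?_⟩
    have hd' := Finset.disjoint_left.1 hd
    have fc := flips_sub c hc
    have ft := flips_sub t ht
    have hk := kids_sub (sortT t)
    rw [lab_congr (labels_sortT t)] at hk
    rw [Finset.disjoint_left]
    intro x hx hx'
    rw [Finset.empty_union, Finset.mem_union] at hx
    rcases Finset.mem_insert.1 hx' with rfl | hx'
    · rcases hx with hx | hx
      · exact lt_irrefl _ (fc _ hx).2
      · exact hd' (minLabel_mem c) (ft _ hx).1
    · rcases hx with hx | hx
      · exact hd' (fc _ hx).1 (hk hx')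
      · exact Finset.disjoint_left.1 h2 hx hx'

theorem unsort_root (E : Finset ℕ) (t : LTree) : Disjoint E (kids t) →
    rootLabel (unsort E t) = rootLabel t ∧ rootDeg (unsort E t) = rootDeg t := by
  induction t using graftInd with
  | h0 a => intro _; rw [unsort_leaf]; simp
  | h1 c t ihc iht =>
    rw [kids_graft, Finset.disjoint_insert_right]
    rintro ⟨h, h'⟩
    obtain ⟨h1, h2⟩ := iht h'
    rw [unsort_graft, if_neg h, rootLabel_graft, rootLabel_graft, rootDeg_graft, rootDeg_graft]
    exact ⟨h1, by rw [h2]⟩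

theorem IsLPT.nodup {n : ℕ} {t : LTree} (h : IsLPT n t) : (labels t).Nodup :=
  h.nodup_iff.2 List.nodup_range'

theorem IsLPT.min_eq {n : ℕ} {t : LTree} (h : IsLPT n t) : minLabel t = 1 := by
  have hm : ∀ x, x ∈ lab t ↔ 1 ≤ x ∧ x < 1 + (n + 1) := by
    intro x
    rw [lab, List.mem_toFinset, h.mem_iff, List.mem_range'_1]
  apply minLabel_eq
  · rw [hm]; omega
  · intro x hx; exact ((hm x).1 hx).1

theorem IsLPT.card {n : ℕ} {t : LTree} (h : IsLPT n t) : (lab t).card = n + 1 := by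
  rw [lab, List.toFinset_card_of_nodup h.nodup, h.length_eq, List.length_range']

/-- The allowed marks. -/
def free (t : LTree) : Finset ℕ := (lab t).erase (rootLabel t) \ kids t

theorem card_free {n : ℕ} {t : LTree} (h : IsLPT n t) (hi : Increasing t) :
    (free t).card = n - rootDeg t := by
  rw [free, Finset.card_sdiff_of_subset, Finset.card_erase_of_mem (rootLabel_mem t), h.card,
    card_kids t h.nodup]
  · rfl
  · intro x hx
    rw [Finset.mem_erase]
    exact ⟨fun e => root_notMem_kids t hi (e ▸ hx), kids_sub t hx⟩

/-- The main bijection. -/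
def mainEquiv (n r k : ℕ) :
    {T : LTree // IsLPT n T ∧ rootLabel T = 1 ∧ rootDeg T = r ∧ impr T = k} ≃
    Σ I : {T : LTree // IsLPT n T ∧ Increasing T ∧ rootDeg T = r},
      {E : Finset ℕ // E ∈ Finset.powersetCard k (free I.1)} where
  toFun T := ⟨⟨sortT T.1, by
      obtain ⟨T, h, h1, hr, hk⟩ := T
      exact ⟨(labels_sortT T).trans h, (sortT_spec T h.nodup).1,
        (sortT_root T h.nodup (h1.trans h.min_eq.symm)).1.trans hr⟩⟩, ⟨flips T.1, by
      obtain ⟨T, h, h1, hr, hk⟩ := T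
      rw [Finset.mem_powersetCard]
      refine ⟨?_, (card_flips T h.nodup).trans hk⟩
      intro x hx
      have hs := flips_sub T h.nodup x hx
      simp only [free]
      rw [Finset.mem_sdiff, Finset.mem_erase, (sortT_spec T h.nodup).2,
        lab_congr (labels_sortT T)]
      exact ⟨⟨hs.2.ne', hs.1⟩,
        Finset.disjoint_left.1 (sortT_root T h.nodup (h1.trans h.min_eq.symm)).2 hx⟩⟩⟩
  invFun p := ⟨unsort p.2.1 p.1.1, by
      obtain ⟨⟨I, h, hi, hr⟩, E, hE⟩ := p
      rw [Finset.mem_powersetCard] at hE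
      obtain ⟨hE, hk⟩ := hE
      have hL : IsLPT n (unsort E I) := (labels_unsort E I).trans h
      have hdj : Disjoint E (kids I) := by
        rw [Finset.disjoint_left]
        intro x hx
        exact (Finset.mem_sdiff.1 (hE hx)).2
      obtain ⟨h1, h2⟩ := unsort_root E I hdj
      refine ⟨hL, ?_, h2.trans hr, ?_⟩
      · exact h1.trans (hi.min_eq.symm.trans h.min_eq)
      · rw [← card_flips _ hL.nodup, ← hk]
        congr 1
        ext x
        rw [flips_unsort E I hi]
        refine ⟨fun h => h.1, fun hx => ?_⟩
        have := Finset.mem_erase.1 (Finset.mem_sdiff.1 (hE hx)).1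
        exact ⟨hx, this.2, this.1⟩⟩
  left_inv := by
    rintro ⟨T, h, h1, hr, hk⟩
    apply Subtype.ext
    exact unsort_sortT T h.nodup _ (fun _ _ _ => Iff.rfl)
  right_inv := by
    rintro ⟨⟨I, h, hi, hr⟩, E, hE⟩
    have e1 : sortT (unsort E I) = I := sortT_unsort E I hi
    have e2 : flips (unsort E I) = E := by
      rw [Finset.mem_powersetCard] at hE
      ext x
      rw [flips_unsort E I hi]
      refine ⟨fun h => h.1, fun hx => ?_⟩
      have := Finset.mem_erase.1 (Finset.mem_sdiff.1 (hE.1 hx)).1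
      exact ⟨hx, this.2, this.1⟩
    apply Sigma.subtype_ext
    · exact Subtype.ext e1
    · exact e2

end LTree

/-- For every `n ≥ 1`, `1 ≤ r ≤ n` and `0 ≤ k ≤ n - r`, the number of labeled plane
trees with `n` edges whose root is labeled `1`, whose root has exactly `r`
children, and which have exactly `k` improper edges equals `S_{n,r} · binom(n-r, k)`. -/
theorem card_rootOne_trees_with_k_improper (n r k : ℕ)
    (hn : 1 ≤ n) (hr1 : 1 ≤ r) (hrn : r ≤ n) (hk : k ≤ n - r) :
    Nat.card {T : LTree // LTree.IsLPT n T ∧ LTree.rootLabel T = 1 ∧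
        LTree.rootDeg T = r ∧ LTree.impr T = k}
      = Snr n r * (n - r).choose k := by
  classical
  have e2 : ∀ I : {T : LTree // LTree.IsLPT n T ∧ LTree.Increasing T ∧ LTree.rootDeg T = r},
      Nonempty ({E : Finset ℕ // E ∈ Finset.powersetCard k (LTree.free I.1)} ≃
        Fin ((n - r).choose k)) := by
    rintro ⟨I, h, hi, hr⟩
    refine ⟨Fintype.equivFinOfCardEq ?_⟩
    rw [Fintype.card_coe, Finset.card_powersetCard, LTree.card_free h hi, hr]
  rw [Nat.card_congr ((LTree.mainEquiv n r k).trans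
    ((Equiv.sigmaCongrRight fun I => (e2 I).some).trans (Equiv.sigmaEquivProd _ _))),
    Nat.card_prod, Nat.card_fin, Snr]
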